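/- Let G be a simple graph on n vertices, let u_1, …, u_k be a placement of k facilities, and let i ≥ 1 and m ≥ 0. Suppose that for every j ∈ [k], the number of vertices at distance exactly i from u_j is at least n − m. Then at least n − k·m vertices are at distance exactly i from all k facilities, and the score of every player lies between (n − k·m)/k and k·m + (n − k·m)/k; in particular, the placement is (k·m)-balanced. -/

import Mathlib

open Finset Filter

open scoped Classical in
/-- The set of players whose facility is (weakly) closest to vertex `v`
(graph distance, `⊤` when disconnected). -/
noncomputable def closestPlayers {n k : ℕ} (G : SimpleGraph (Fin n))
    (u : Fin k → Fin n) (v : Fin n) : Finset (Fin k) :=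
  Finset.univ.filter (fun i => ∀ j : Fin k, G.edist v (u i) ≤ G.edist v (u j))

/-- The score of player `i` in the facility placement `u`:
`∑_{v : i ∈ C_v} 1 / |C_v|`. -/
noncomputable def score {n k : ℕ} (G : SimpleGraph (Fin n))
    (u : Fin k → Fin n) (i : Fin k) : ℝ :=
  ∑ v : Fin n, if i ∈ closestPlayers G u v then ((closestPlayers G u v).card : ℝ)⁻¹ else 0

/-- A placement is `z`-balanced if every player's score is between `⌊n/k⌋ - z`
and `⌈n/k⌉ + z`. -/
def BalancedPlacement {n k : ℕ} (G : SimpleGraph (Fin n))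
    (u : Fin k → Fin n) (z : ℝ) : Prop :=
  ∀ i : Fin k, ((n / k : ℕ) : ℝ) - z ≤ score G u i ∧
    score G u i ≤ (((n + k - 1) / k : ℕ) : ℝ) + z

/-- A graph is `z`-balanced for `k` players if every placement of `k` facilities on
distinct vertices is `z`-balanced. -/
def IsBalanced (n k : ℕ) (G : SimpleGraph (Fin n)) (z : ℝ) : Prop :=
  ∀ u : Fin k → Fin n, Function.Injective u → BalancedPlacement G u z

open scoped Classical in
theorem closestPlayers_eq_univ {n k : ℕ} (G : SimpleGraph (Fin n)) (u : Fin k → Fin n)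
    (v : Fin n) (d : ℕ∞) (h : ∀ j, G.edist v (u j) = d) :
    closestPlayers G u v = Finset.univ := by
  simp [closestPlayers, h]

/-- If each `p j` holds for at least `n - m` elements of an `n`-element type, then at least
`n - k * m` elements satisfy all `k` of them. -/
theorem sub_mul_le_card_filter_forall {α : Type*} [Fintype α] {k : ℕ} (p : Fin k → α → Prop)
    [∀ j, DecidablePred (p j)] [DecidablePred fun w => ∀ j, p j w] (m : ℝ)
    (h : ∀ j, (Fintype.card α : ℝ) - m ≤ ((Finset.univ.filter (p j)).card : ℝ)) :
    (Fintype.card α : ℝ) - k * m ≤ ((Finset.univ.filter (fun w => ∀ j, p j w)).card : ℝ) := by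
  classical
  have hcompl : ∀ (q : α → Prop) [DecidablePred q], ((Finset.univ.filter q).card : ℝ) +
      ((Finset.univ.filter (fun w => ¬ q w)).card : ℝ) = Fintype.card α := fun q _ => by
    exact_mod_cast Finset.card_filter_add_card_filter_not (s := Finset.univ) q
  have hunion : (Finset.univ.filter (fun w => ¬ ∀ j, p j w)) =
      Finset.univ.biUnion (fun j => Finset.univ.filter (fun w => ¬ p j w)) := by
    ext w
    simp
  have hle : ((Finset.univ.filter (fun w => ¬ ∀ j, p j w)).card : ℝ) ≤
      ∑ j : Fin k, ((Finset.univ.filter (fun w => ¬ p j w)).card : ℝ) := by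
    rw [hunion]
    exact_mod_cast Finset.card_biUnion_le
  have hsum : ∑ j : Fin k, ((Finset.univ.filter (fun w => ¬ p j w)).card : ℝ) ≤ k * m := by
    calc _ ≤ ∑ _j : Fin k, m :=
          Finset.sum_le_sum fun j _ => by linarith [h j, hcompl (p j)]
      _ = k * m := by simp
  linarith [hcompl (fun w => ∀ j, p j w)]

/-- A player collects exactly `1 / k` from each vertex equidistant from all facilities, and
between `0` and `1` from every other vertex. -/
theorem score_bounds_of_equidistant {n k : ℕ} (G : SimpleGraph (Fin n)) (u : Fin k → Fin n)
    (d : ℕ∞) (S : Finset (Fin n)) (hS : ∀ v ∈ S, ∀ j, G.edist v (u j) = d) (j : Fin k) :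
    (S.card : ℝ) / k ≤ score G u j ∧ score G u j ≤ (n - S.card) + (S.card : ℝ) / k := by
  classical
  let f : Fin n → ℝ := fun v =>
    if j ∈ closestPlayers G u v then ((closestPlayers G u v).card : ℝ)⁻¹ else 0
  have hsplit : score G u j = ∑ v ∈ S, f v + ∑ v ∈ Sᶜ, f v :=
    (Finset.sum_add_sum_compl S f).symm
  have hin : ∑ v ∈ S, f v = (S.card : ℝ) / k := by
    rw [Finset.sum_congr rfl (g := fun _ => (k : ℝ)⁻¹)
      fun v hv => by simp [f, closestPlayers_eq_univ G u v d (hS v hv)]]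
    simp [div_eq_mul_inv]
  have hnonneg : 0 ≤ ∑ v ∈ Sᶜ, f v := Finset.sum_nonneg fun v _ => by
    simp only [f]
    split_ifs <;> positivity
  have hout : ∑ v ∈ Sᶜ, f v ≤ n - S.card := by
    have hcard : (S.card : ℝ) + (Sᶜ.card : ℝ) = n := by
      exact_mod_cast (Finset.card_add_card_compl S).trans (Fintype.card_fin n)
    calc _ ≤ ∑ _v ∈ Sᶜ, (1 : ℝ) := Finset.sum_le_sum fun v _ => by
          simp only [f]
          split_ifs
          · exact Nat.cast_inv_le_one _
          · exact zero_le_one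
      _ = n - S.card := by
          rw [Finset.sum_const, nsmul_eq_mul, mul_one]
          linarith
  constructor <;> linarith

open scoped Classical in
/-- If for every facility at least `n - m` vertices are at distance exactly `i`
from it, then at least `n - k·m` vertices are at distance exactly `i` from all `k`
facilities, every player's score lies between `(n - k·m)/k` and `k·m + (n - k·m)/k`, and in
particular the placement is `k·m`-balanced. -/
theorem balanced_of_common_sphere (n k m i : ℕ) (hk : 1 ≤ k) (hi : 1 ≤ i)
    (G : SimpleGraph (Fin n)) (u : Fin k → Fin n) (hu : Function.Injective u)
    (h : ∀ j : Fin k,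
      (n : ℝ) - m ≤
        ((Finset.univ.filter (fun w : Fin n => G.edist w (u j) = (i : ℕ∞))).card : ℝ)) :
    ((n : ℝ) - k * m ≤
      ((Finset.univ.filter
        (fun w : Fin n => ∀ j : Fin k, G.edist w (u j) = (i : ℕ∞))).card : ℝ)) ∧
    (∀ j : Fin k,
      ((n : ℝ) - k * m) / k ≤ score G u j ∧
        score G u j ≤ (k : ℝ) * m + ((n : ℝ) - k * m) / k) ∧
    BalancedPlacement G u ((k : ℝ) * m) := by
  have hk' : (1 : ℝ) ≤ k := by exact_mod_cast hk
  have hk0 : (0 : ℝ) < k := by linarith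
  have hm : (0 : ℝ) ≤ m := m.cast_nonneg
  set S := Finset.univ.filter (fun w : Fin n => ∀ j : Fin k, G.edist w (u j) = (i : ℕ∞))
  have hcard : (n : ℝ) - k * m ≤ (S.card : ℝ) := by
    have := sub_mul_le_card_filter_forall
      (fun (j : Fin k) (w : Fin n) => G.edist w (u j) = (i : ℕ∞)) m
      (by simpa only [Fintype.card_fin] using h)
    simpa only [Fintype.card_fin] using this
  have hscore : ∀ j : Fin k, ((n : ℝ) - k * m) / k ≤ score G u j ∧
      score G u j ≤ (k : ℝ) * m + ((n : ℝ) - k * m) / k := fun j => by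
    obtain ⟨hlow, hup⟩ := score_bounds_of_equidistant G u i S
      (fun v hv => (Finset.mem_filter.mp hv).2) j
    have hdiv : ((n : ℝ) - k * m) / k ≤ S.card / k := by gcongr
    have hgap : (S.card : ℝ) / k - ((n : ℝ) - k * m) / k ≤ S.card - ((n : ℝ) - k * m) := by
      rw [← sub_div]
      exact div_le_self (by linarith) hk'
    constructor <;> linarith
  refine ⟨hcard, hscore, fun j => ?_⟩
  obtain ⟨hlow, hup⟩ := hscore j
  have heq : ((n : ℝ) - k * m) / k = n / k - m := by field_simp
  have hmk : (m : ℝ) ≤ k * m := le_mul_of_one_le_left hm hk'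
  have hfloor : ((n / k : ℕ) : ℝ) ≤ n / k := Nat.cast_div_le
  have hceil : (n : ℝ) / k ≤ ((n + k - 1) / k : ℕ) := by
    rw [div_le_iff₀ hk0]
    have : n ≤ (n + k - 1) / k * k := by
      have hmod := Nat.div_add_mod' (n + k - 1) k
      have hlt := Nat.mod_lt (n + k - 1) hk
      omega
    exact_mod_cast this
  constructor <;> linarith
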